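/- arXiv:2302.11636 — 2 statements merged into one kernel-verified Lean document; each statement's English description precedes it below -/
import Mathlib

section
/- Let G : ℝ^d → ℝ be a two-layer ReLU neural network, G(x) = Σ_{k=1}^K c_k · max(0, ⟨w_k, x⟩ + b_k). For any direction v ∈ ℝ^d there exist a constant ε_v ∈ ℝ (depending only on G and v) and a constant C > 0 such that for all t > 0 and all h > 0, setting x₁ = t·v and x₂ = (t + h)·v, one has |(G(x₂) − G(x₁))/h − ε_v| ≤ C/t. -/
open scoped RealInnerProductSpace

theorem relu_aux (a b t h : ℝ) (ht : 0 < t) (hh : 0 < h) :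
    |(max 0 ((t + h) * a + b) - max 0 (t * a + b)) / h - max 0 a| ≤ |b| / t := by
  rw [le_div_iff₀ ht]
  have key : ∃ q, max 0 ((t + h) * a + b) - max 0 (t * a + b) = q * h ∧
      |q - max 0 a| * t ≤ |b| := by
    refine ⟨(max 0 ((t + h) * a + b) - max 0 (t * a + b)) / h, by field_simp, ?_⟩
    set q := (max 0 ((t + h) * a + b) - max 0 (t * a + b)) / h with hq
    have hqh : q * h = max 0 ((t + h) * a + b) - max 0 (t * a + b) := by
      rw [hq]; field_simp
    have hb1 := le_abs_self b
    have hb2 := neg_abs_le b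
    have hb0 := abs_nonneg b
    rcases le_total 0 a with ha | ha
    · have hah : 0 ≤ h * a := by positivity
      rw [max_eq_right ha]
      rcases le_total 0 (t * a + b) with h1 | h1
      · rw [max_eq_right h1, max_eq_right (by linarith)] at hqh
        have : q = a := mul_right_cancel₀ hh.ne' (by linarith)
        rw [this]; simp
      · rw [max_eq_left h1, sub_zero] at hqh
        have hq0 : 0 ≤ q := by
          by_contra hc
          have := mul_neg_of_neg_of_pos (not_le.mp hc) hh
          have := le_max_left 0 ((t + h) * a + b)
          linarith
        have hqa : q ≤ a := by
          refine le_of_mul_le_mul_right ?_ hh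
          rw [hqh]
          exact max_le (by linarith) (by linarith)
        rw [abs_of_nonpos (by linarith)]
        nlinarith
    · have hah : h * a ≤ 0 := mul_nonpos_of_nonneg_of_nonpos hh.le ha
      rw [max_eq_left ha, sub_zero]
      rcases le_total 0 (t * a + b) with h1 | h1
      · rw [max_eq_right h1] at hqh
        have hq0 : q ≤ 0 := by
          refine le_of_mul_le_mul_right ?_ hh
          rw [hqh, zero_mul]
          have : max 0 ((t + h) * a + b) ≤ t * a + b := max_le h1 (by linarith)
          linarith
        have hqa : a ≤ q := by
          refine le_of_mul_le_mul_right ?_ hh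
          rw [hqh]
          have := le_max_right 0 ((t + h) * a + b)
          linarith
        rw [abs_of_nonpos hq0]
        nlinarith
      · rw [max_eq_left h1, max_eq_left (by linarith)] at hqh
        have : q = 0 := mul_right_cancel₀ hh.ne' (by linarith)
        rw [this]; simp
  obtain ⟨q, h1, h2⟩ := key
  rw [h1, mul_div_cancel_right₀ _ hh.ne']
  exact h2

/-- **Linear extrapolation (Xu et al. 2020).**
For a two-layer ReLU network `G x = ∑ k, c k * max 0 (⟪w k, x⟫ + b k)` and any
direction `v`, there exist a constant `ε_v` and a constant `C > 0` such that for
all `t > 0` and `h > 0`, with `x₁ = t • v` and `x₂ = (t + h) • v`,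
`|(G x₂ - G x₁) / h - ε_v| ≤ C / t`. -/
theorem two_layer_relu_linear_extrapolation
    (d K : ℕ) (w : Fin K → EuclideanSpace ℝ (Fin d)) (c b : Fin K → ℝ)
    (v : EuclideanSpace ℝ (Fin d)) :
    ∃ ε : ℝ, ∃ C > (0 : ℝ), ∀ t > (0 : ℝ), ∀ h > (0 : ℝ),
      |((∑ k : Fin K, c k * max 0 (⟪w k, (t + h) • v⟫ + b k))
          - (∑ k : Fin K, c k * max 0 (⟪w k, t • v⟫ + b k))) / h - ε| ≤ C / t := by
  refine ⟨∑ k, c k * max 0 ⟪w k, v⟫, (∑ k, |c k| * |b k|) + 1, by positivity, ?_⟩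
  intro t ht h hh
  simp only [inner_smul_right]
  have e : ((∑ k : Fin K, c k * max 0 ((t + h) * ⟪w k, v⟫ + b k))
          - (∑ k : Fin K, c k * max 0 (t * ⟪w k, v⟫ + b k))) / h
          - ∑ k, c k * max 0 ⟪w k, v⟫ =
      ∑ k, c k * ((max 0 ((t + h) * ⟪w k, v⟫ + b k) - max 0 (t * ⟪w k, v⟫ + b k)) / h
        - max 0 ⟪w k, v⟫) := by
    rw [← Finset.sum_sub_distrib, Finset.sum_div, ← Finset.sum_sub_distrib]
    exact Finset.sum_congr rfl fun k _ => by ring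
  rw [e]
  calc _ ≤ ∑ k, |c k| * (|b k| / t) := by
        refine (Finset.abs_sum_le_sum_abs _ _).trans (Finset.sum_le_sum fun k _ => ?_)
        rw [abs_mul]
        exact mul_le_mul_of_nonneg_left (relu_aux _ _ _ _ ht hh) (abs_nonneg _)
    _ = (∑ k, |c k| * |b k|) / t := by
        rw [Finset.sum_div]
        exact Finset.sum_congr rfl fun k _ => by ring
    _ ≤ _ := by gcongr; linarith
end

section
/- Let F : ℝ^d → ℝ be the polynomial target function F(x) = Σ_{j=1}^m α_j (⟨β_j, x⟩)^p, where p ≥ 2 is a positive even integer, α_j ∈ ℝ, β_j ∈ ℝ^d. Let v ∈ ℝ^d be any direction with Σ_{j=1}^m α_j (⟨β_j, v⟩)^p ≠ 0. Then for every two-layer ReLU neural network G(x) = Σ_{k=1}^K c_k · max(0, ⟨w_k, x⟩ + b_k), one has lim_{t → ∞} |F(t·v) − G(t·v)| = ∞. In particular, no two-layer ReLU network extrapolates F along such a ray. -/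
open scoped RealInnerProductSpace
open Filter

/-- **Two-layer ReLU networks cannot extrapolate even-degree polynomials.**
Let `F x = ∑ j, α j * ⟪β j, x⟫ ^ p` with `p ≥ 2` even, and let `v` be a direction
with `∑ j, α j * ⟪β j, v⟫ ^ p ≠ 0`. Then for every two-layer ReLU network
`G x = ∑ k, c k * max 0 (⟪w k, x⟫ + b k)`, `|F (t • v) - G (t • v)| → ∞` as `t → ∞`. -/
theorem two_layer_relu_cannot_extrapolate_even_polynomial
    (d m K : ℕ) (p : ℕ) (hp2 : 2 ≤ p) (hpeven : Even p)
    (α : Fin m → ℝ) (β : Fin m → EuclideanSpace ℝ (Fin d))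
    (w : Fin K → EuclideanSpace ℝ (Fin d)) (c b : Fin K → ℝ)
    (v : EuclideanSpace ℝ (Fin d))
    (hv : (∑ j : Fin m, α j * ⟪β j, v⟫ ^ p) ≠ 0) :
    Tendsto
      (fun t : ℝ =>
        |(∑ j : Fin m, α j * ⟪β j, t • v⟫ ^ p)
          - (∑ k : Fin K, c k * max 0 (⟪w k, t • v⟫ + b k))|)
      atTop atTop := by
  set A := ∑ j : Fin m, α j * ⟪β j, v⟫ ^ p with hA
  set C := ∑ k : Fin K, |c k| * (|⟪w k, v⟫| + |b k|) with hC
  have hlim : Tendsto (fun t : ℝ => t * (|A| * t + -C)) atTop atTop := by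
    apply Tendsto.atTop_mul_atTop₀ tendsto_id
    apply tendsto_atTop_add_const_right
    exact Tendsto.const_mul_atTop (abs_pos.mpr hv) tendsto_id
  refine tendsto_atTop_mono' _ ?_ hlim
  filter_upwards [eventually_ge_atTop (1 : ℝ)] with t ht
  have ht0 : 0 ≤ t := by linarith
  have hF : (∑ j : Fin m, α j * ⟪β j, t • v⟫ ^ p) = A * t ^ p := by
    rw [hA, Finset.sum_mul]
    refine Finset.sum_congr rfl fun j _ => ?_
    rw [real_inner_smul_right, mul_pow]
    ring
  have hG : |∑ k : Fin K, c k * max 0 (⟪w k, t • v⟫ + b k)| ≤ C * t := by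
    refine (Finset.abs_sum_le_sum_abs _ _).trans ?_
    rw [hC, Finset.sum_mul]
    refine Finset.sum_le_sum fun k _ => ?_
    rw [abs_mul, mul_assoc, real_inner_smul_right]
    refine mul_le_mul_of_nonneg_left ?_ (abs_nonneg _)
    rw [abs_of_nonneg (le_max_left _ _)]
    have h1 := mul_le_mul_of_nonneg_left (le_abs_self ⟪w k, v⟫) ht0
    have h2 := le_abs_self (b k)
    have h3 := abs_nonneg (b k)
    have h4 := mul_nonneg ht0 (abs_nonneg ⟪w k, v⟫)
    refine max_le (by positivity) ?_
    nlinarith [mul_nonneg h3 (sub_nonneg.mpr ht)]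
  have hpow : t ^ 2 ≤ t ^ p := pow_le_pow_right₀ ht hp2
  have h5 := mul_le_mul_of_nonneg_left hpow (abs_nonneg A)
  have h6 := abs_sub_abs_le_abs_sub (A * t ^ p)
    (∑ k : Fin K, c k * max 0 (⟪w k, t • v⟫ + b k))
  rw [abs_mul, abs_of_nonneg (pow_nonneg ht0 p)] at h6
  rw [hF]
  nlinarith
end
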